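/- For every n ≥ 1, the total number of Schröder paths of semilength n in which every diagonal step is immediately followed by a horizontal step except if it is the last step (i.e., Σ_{m≥0} |RP(n,m)|) equals twice the number of (h,u)-colored Motzkin paths of length n−1: Σ_{m≥0} |RP(n,m)| = 2·|huMP(n)|. -/

import Mathlib

/-! Schröder paths -/

inductive SStep : Type
  | H | V | D
deriving DecidableEq

def SStep.dx : SStep → ℕ
  | .H => 1 | .V => 0 | .D => 1

def SStep.dy : SStep → ℕ
  | .H => 0 | .V => 1 | .D => 1

def pathX (p : List SStep) : ℕ := (p.map SStep.dx).sum
def pathY (p : List SStep) : ℕ := (p.map SStep.dy).sum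

/-- A Schröder path of semilength `n`: from (0,0) to (n,n), steps H,V,D,
never rising above the diagonal. -/
def IsSchroder (n : ℕ) (p : List SStep) : Prop :=
  pathX p = n ∧ pathY p = n ∧ ∀ q : List SStep, q <+: p → pathY q ≤ pathX q

/-- No diagonal step starts on the diagonal. -/
def DiagFree (p : List SStep) : Prop :=
  ∀ q r : List SStep, p = q ++ SStep.D :: r → pathX q ≠ pathY q

/-- Every diagonal step is immediately followed by a horizontal step,
except if it is the last step. -/
def DFollowedByH (p : List SStep) : Prop :=
  ∀ q r : List SStep, p = q ++ SStep.D :: r → r = [] ∨ ∃ r' : List SStep, r = SStep.H :: r'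

def SP (n m : ℕ) : Type := {p : List SStep // IsSchroder n p ∧ p.count SStep.D + m = n}
def SPplus (n m : ℕ) : Type :=
  {p : List SStep // IsSchroder n p ∧ p.count SStep.D + m = n ∧ DiagFree p}
def SPzero (n m : ℕ) : Type :=
  {p : List SStep // IsSchroder n p ∧ p.count SStep.D + m = n ∧ ¬ DiagFree p}
def RP (n m : ℕ) : Type :=
  {p : List SStep // IsSchroder n p ∧ p.count SStep.D + m = n ∧ DFollowedByH p}

/-! Rooted planar trees -/

inductive PTree : Type
  | node : List PTree → PTree

namespace PTree

def leaves : PTree → ℕ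
  | node [] => 1
  | node (c :: cs) => ((c :: cs).attach.map fun x => leaves x.1).sum
decreasing_by
  have := List.sizeOf_lt_of_mem x.2
  simp only [PTree.node.sizeOf_spec, List.cons.sizeOf_spec] at this ⊢
  omega

def internal : PTree → ℕ
  | node [] => 0
  | node (c :: cs) => 1 + ((c :: cs).attach.map fun x => internal x.1).sum
decreasing_by
  have := List.sizeOf_lt_of_mem x.2
  simp only [PTree.node.sizeOf_spec, List.cons.sizeOf_spec] at this ⊢
  omega

def Good : PTree → Prop
  | node cs => cs.length ≠ 1 ∧ ∀ c ∈ cs.attach, Good c.1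
decreasing_by
  have := List.sizeOf_lt_of_mem c.2
  simp only [PTree.node.sizeOf_spec] at this ⊢
  omega

end PTree

def PT (n m : ℕ) : Type :=
  {t : PTree // t.Good ∧ t.leaves = n + 1 ∧ t.internal = m}

def PTn (n : ℕ) : Type := {t : PTree // t.Good ∧ t.leaves = n + 1}

/-! Motzkin paths -/

inductive MStep : Type
  | U | H | D
deriving DecidableEq

def MStep.dh : MStep → ℤ
  | .U => 1 | .H => 0 | .D => -1

def mHeight (p : List MStep) : ℤ := (p.map MStep.dh).sum

def IsMotzkin (k : ℕ) (p : List MStep) : Prop :=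
  p.length = k ∧ mHeight p = 0 ∧ ∀ q : List MStep, q <+: p → 0 ≤ mHeight q

def HFollowedByU (p : List MStep) : Prop :=
  ∀ q r : List MStep, p = q ++ MStep.H :: r → r = [] ∨ ∃ r' : List MStep, r = MStep.U :: r'

def MP (k : ℕ) : Type := {p : List MStep // IsMotzkin k p}
def RMP (k : ℕ) : Type := {p : List MStep // IsMotzkin k p ∧ HFollowedByU p}

/-- Motzkin steps with two possible colors on up and horizontal steps. -/
inductive CMStep : Type
  | U : Bool → CMStep
  | H : Bool → CMStep
  | D : CMStep
deriving DecidableEq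

def CMStep.forget : CMStep → MStep
  | .U _ => .U | .H _ => .H | .D => .D

/-- (h,u)-colored Motzkin paths of length n-1. -/
def huMP (n : ℕ) : Type := {p : List CMStep // IsMotzkin (n - 1) (p.map CMStep.forget)}


section Recursion

open PowerSeries

/-- Final segments, starting at depth `h` below the diagonal with `n` horizontal units left, of
Schröder paths in which every non-final diagonal step is followed by a horizontal step. -/
def IsSchroderTail (n h : ℕ) (p : List SStep) : Prop :=
  pathX p = n ∧ pathY p = n + h ∧ (∀ q : List SStep, q <+: p → pathY q ≤ pathX q + h) ∧
    DFollowedByH p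

lemma forall_prefix_cons {α : Type*} {a : α} {p : List α} {P : List α → Prop} :
    (∀ q, q <+: a :: p → P q) ↔ P [] ∧ ∀ q, q <+: p → P (a :: q) := by
  simp only [List.prefix_cons_iff]
  constructor
  · intro h
    exact ⟨h [] (Or.inl rfl), fun q hq => h _ (Or.inr ⟨q, rfl, hq⟩)⟩
  · rintro ⟨h₀, h⟩ q (rfl | ⟨t, rfl, ht⟩)
    exacts [h₀, h t ht]

lemma dFollowedByH_cons {a : SStep} {p : List SStep} :
    DFollowedByH (a :: p) ↔
      (a = SStep.D → p = [] ∨ ∃ r, p = SStep.H :: r) ∧ DFollowedByH p := by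
  constructor
  · intro h
    refine ⟨fun ha => h [] p (by simp [ha]), fun q r hr => h (a :: q) r (by simp [hr])⟩
  · rintro ⟨h₁, h₂⟩ (_ | ⟨b, q⟩) r hr
    · simp only [List.nil_append, List.cons.injEq] at hr
      exact hr.2 ▸ h₁ hr.1
    · simp only [List.cons_append, List.cons.injEq] at hr
      exact h₂ q r hr.2

lemma dFollowedByH_nil : DFollowedByH [] := by
  intro q r h
  simp at h

lemma pathX_cons (a : SStep) (p : List SStep) : pathX (a :: p) = a.dx + pathX p := by
  simp [pathX]

lemma pathY_cons (a : SStep) (p : List SStep) : pathY (a :: p) = a.dy + pathY p := by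
  simp [pathY]

lemma isSchroderTail_nil {n h : ℕ} : IsSchroderTail n h [] ↔ n = 0 ∧ h = 0 := by
  simp only [IsSchroderTail, dFollowedByH_nil, List.prefix_nil, forall_eq]
  simp [pathX, pathY]
  omega

lemma isSchroderTail_H {n h : ℕ} {p : List SStep} :
    IsSchroderTail n h (SStep.H :: p) ↔ ∃ k, n = k + 1 ∧ IsSchroderTail k (h + 1) p := by
  simp only [IsSchroderTail, dFollowedByH_cons, forall_prefix_cons, pathX_cons, pathY_cons,
    SStep.dx, SStep.dy, reduceCtorEq, false_imp_iff, true_and]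
  constructor
  · rintro ⟨hx, hy, ⟨-, hq⟩, hd⟩
    exact ⟨pathX p, by omega, rfl, by omega, fun q hq' => by have := hq q hq'; omega, hd⟩
  · rintro ⟨k, rfl, hx, hy, hq, hd⟩
    exact ⟨by omega, by omega,
      ⟨by simp [pathX, pathY], fun q hq' => by have := hq q hq'; omega⟩, hd⟩

lemma isSchroderTail_V {n h : ℕ} {p : List SStep} :
    IsSchroderTail n h (SStep.V :: p) ↔ ∃ k, h = k + 1 ∧ IsSchroderTail n k p := by
  simp only [IsSchroderTail, dFollowedByH_cons, forall_prefix_cons, pathX_cons, pathY_cons,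
    SStep.dx, SStep.dy, reduceCtorEq, false_imp_iff, true_and]
  constructor
  · rintro ⟨hx, hy, ⟨-, hq⟩, hd⟩
    have h₀ := hq [] List.nil_prefix
    simp only [pathX, pathY, List.map_nil, List.sum_nil] at h₀
    exact ⟨h - 1, by omega, by omega, by omega,
      fun q hq' => by have := hq q hq'; omega, hd⟩
  · rintro ⟨k, rfl, hx, hy, hq, hd⟩
    exact ⟨by omega, by omega,
      ⟨by simp [pathX, pathY], fun q hq' => by have := hq q hq'; omega⟩, hd⟩

lemma isSchroderTail_D {n h : ℕ} {p : List SStep} :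
    IsSchroderTail n h (SStep.D :: p) ↔
      (p = [] ∨ ∃ r, p = SStep.H :: r) ∧ ∃ k, n = k + 1 ∧ IsSchroderTail k h p := by
  simp only [IsSchroderTail, dFollowedByH_cons, forall_prefix_cons, pathX_cons, pathY_cons,
    SStep.dx, SStep.dy, true_imp_iff]
  constructor
  · rintro ⟨hx, hy, ⟨-, hq⟩, hp, hd⟩
    exact ⟨hp, pathX p, by omega, rfl, by omega,
      fun q hq' => by have := hq q hq'; omega, hd⟩
  · rintro ⟨hp, k, rfl, hx, hy, hq, hd⟩
    exact ⟨by omega, by omega,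
      ⟨by simp [pathX, pathY], fun q hq' => by have := hq q hq'; omega⟩, hp, hd⟩

/-- The finite set of lists satisfying `IsSchroderTail n h`. -/
def schroderTails : ℕ → ℕ → Finset (List SStep)
  | 0, 0 => {[]}
  | 0, h + 1 => (schroderTails 0 h).image (List.cons SStep.V)
  | 1, 0 => {[SStep.D]} ∪ (schroderTails 0 1).image (List.cons SStep.H)
  | 1, h + 1 => (schroderTails 1 h).image (List.cons SStep.V) ∪
      (schroderTails 0 (h + 2)).image (List.cons SStep.H)
  | n + 2, 0 => (schroderTails (n + 1) 1).image (List.cons SStep.H) ∪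
      (schroderTails n 1).image (fun p => SStep.D :: SStep.H :: p)
  | n + 2, h + 1 => (schroderTails (n + 2) h).image (List.cons SStep.V) ∪
      ((schroderTails (n + 1) (h + 2)).image (List.cons SStep.H) ∪
        (schroderTails n (h + 2)).image (fun p => SStep.D :: SStep.H :: p))
termination_by n h => (n, h)

lemma mem_schroderTails : ∀ (p : List SStep) (n h : ℕ),
    p ∈ schroderTails n h ↔ IsSchroderTail n h p
  | [], n, h => by
    rw [isSchroderTail_nil]
    rcases n with _ | _ | n <;> rcases h with _ | h <;> simp [schroderTails]
  | SStep.H :: p, n, h => by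
    have ih := mem_schroderTails p
    rw [isSchroderTail_H]
    rcases n with _ | _ | n <;> rcases h with _ | h <;> simp [schroderTails, ← ih]
  | SStep.V :: p, n, h => by
    have ih := mem_schroderTails p
    rw [isSchroderTail_V]
    rcases n with _ | _ | n <;> rcases h with _ | h <;> simp [schroderTails, ih]
  | [SStep.D], n, h => by
    simp only [isSchroderTail_D, isSchroderTail_nil]
    rcases n with _ | _ | n <;> rcases h with _ | h <;> simp [schroderTails]
  | SStep.D :: SStep.H :: p, n, h => by
    have ih := mem_schroderTails p
    simp only [isSchroderTail_D, isSchroderTail_H]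
    rcases n with _ | _ | n <;> rcases h with _ | h <;> simp [schroderTails, ih]
  | SStep.D :: SStep.V :: p, n, h => by
    simp only [isSchroderTail_D]
    rcases n with _ | _ | n <;> rcases h with _ | h <;> simp [schroderTails]
  | SStep.D :: SStep.D :: p, n, h => by
    simp only [isSchroderTail_D]
    rcases n with _ | _ | n <;> rcases h with _ | h <;> simp [schroderTails]

lemma coeff_eq_card_schroderTails {S : ℤ⟦X⟧} (hS : S = 1 + (X + X ^ 2) * S ^ 2) (n h : ℕ) :
    coeff n ((1 + X) * S ^ (h + 1)) = ((schroderTails n h).card : ℤ) := by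
  have hcons : ∀ a : SStep, Function.Injective (List.cons a) := fun _ => List.cons_injective
  have hcons₂ : Function.Injective (fun p => SStep.D :: SStep.H :: p) :=
    fun _ _ h => by simpa using h
  have h₀ : (1 + X) * S ^ (0 + 1) =
      1 + X + X * ((1 + X) * S ^ (1 + 1)) + X * (X * ((1 + X) * S ^ (1 + 1))) := by
    linear_combination (1 + X) * hS
  have h₁ : ∀ h, (1 + X) * S ^ (h + 1 + 1) = (1 + X) * S ^ (h + 1) +
      X * ((1 + X) * S ^ (h + 2 + 1)) + X * (X * ((1 + X) * S ^ (h + 2 + 1))) := by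
    intro h
    linear_combination (1 + X) * S ^ (h + 1) * hS
  induction n, h using schroderTails.induct with
  | case1 => rw [h₀]; simp [schroderTails]
  | case2 h ih =>
    rw [h₁, schroderTails, Finset.card_image_of_injective _ (hcons _), ← ih]
    simp
  | case3 ih =>
    rw [h₀, schroderTails, Finset.card_union_of_disjoint (by simp),
      Finset.card_image_of_injective _ (hcons _)]
    push_cast
    rw [← ih]
    simp [coeff_succ_X_mul, coeff_one]
  | case4 h ih₁ ih₂ =>
    rw [h₁, schroderTails, Finset.card_union_of_disjoint (by simp [Finset.disjoint_left]),
      Finset.card_image_of_injective _ (hcons _), Finset.card_image_of_injective _ (hcons _)]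
    push_cast
    rw [← ih₁, ← ih₂]
    have hX : ∀ A : ℤ⟦X⟧, coeff 1 (X * A) = coeff 0 A := coeff_succ_X_mul 0
    simp [hX]
  | case5 n ih₁ ih₂ =>
    rw [h₀, schroderTails, Finset.card_union_of_disjoint (by simp [Finset.disjoint_left]),
      Finset.card_image_of_injective _ (hcons _), Finset.card_image_of_injective _ hcons₂]
    push_cast
    rw [← ih₁, ← ih₂]
    simp only [map_add, coeff_succ_X_mul]
    simp [coeff_one, coeff_X]
  | case6 n h ih₁ ih₂ ih₃ =>
    rw [h₁, schroderTails, Finset.card_union_of_disjoint (by simp [Finset.disjoint_left]),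
      Finset.card_union_of_disjoint (by simp [Finset.disjoint_left]),
      Finset.card_image_of_injective _ (hcons _), Finset.card_image_of_injective _ (hcons _),
      Finset.card_image_of_injective _ hcons₂]
    push_cast
    rw [← ih₁, ← ih₂, ← ih₃]
    simp only [map_add, coeff_succ_X_mul]
    ring

/-- Final segments of length `k`, starting at height `h`, of colored Motzkin paths. -/
def IsMotzkinTail (k h : ℕ) (p : List CMStep) : Prop :=
  p.length = k ∧ h + mHeight (p.map CMStep.forget) = 0 ∧
    ∀ q : List MStep, q <+: p.map CMStep.forget → 0 ≤ h + mHeight q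

lemma mHeight_nil : mHeight [] = 0 := rfl

lemma mHeight_cons (a : MStep) (p : List MStep) : mHeight (a :: p) = a.dh + mHeight p := by
  simp [mHeight]

lemma isMotzkinTail_nil {k h : ℕ} : IsMotzkinTail k h [] ↔ k = 0 ∧ h = 0 := by
  simp only [IsMotzkinTail, List.map_nil, List.prefix_nil, forall_eq, mHeight_nil,
    List.length_nil]
  omega

lemma isMotzkinTail_cons {k h : ℕ} {a : CMStep} {p : List CMStep} :
    IsMotzkinTail k h (a :: p) ↔ ∃ k' h' : ℕ, k = k' + 1 ∧ (h' : ℤ) = h + a.forget.dh ∧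
      IsMotzkinTail k' h' p := by
  simp only [IsMotzkinTail, List.map_cons, forall_prefix_cons, mHeight_cons, List.length_cons]
  constructor
  · rintro ⟨hl, hm, -, hq⟩
    have h₀ := hq [] List.nil_prefix
    rw [mHeight_nil] at h₀
    exact ⟨p.length, (h + a.forget.dh).toNat, hl.symm, by omega, rfl, by omega,
      fun q hq' => by have := hq q hq'; omega⟩
  · rintro ⟨k', h', rfl, hh, hl, hm, hq⟩
    exact ⟨by omega, by omega, by simp [mHeight_nil],
      fun q hq' => by have := hq q hq'; omega⟩

/-- The finite set of lists satisfying `IsMotzkinTail k h`. -/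
def motzkinTails : ℕ → ℕ → Finset (List CMStep)
  | 0, 0 => {[]}
  | 0, _ + 1 => ∅
  | k + 1, 0 => (Finset.univ ×ˢ motzkinTails k 1).image (fun x => CMStep.U x.1 :: x.2) ∪
      (Finset.univ ×ˢ motzkinTails k 0).image (fun x => CMStep.H x.1 :: x.2)
  | k + 1, h + 1 => (motzkinTails k h).image (List.cons CMStep.D) ∪
      ((Finset.univ ×ˢ motzkinTails k (h + 2)).image (fun x => CMStep.U x.1 :: x.2) ∪
        (Finset.univ ×ˢ motzkinTails k (h + 1)).image (fun x => CMStep.H x.1 :: x.2))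

lemma mem_motzkinTails (p : List CMStep) (k h : ℕ) :
    p ∈ motzkinTails k h ↔ IsMotzkinTail k h p := by
  induction p generalizing k h with
  | nil =>
    rw [isMotzkinTail_nil]
    rcases k with _ | k <;> rcases h with _ | h <;> simp [motzkinTails]
  | cons a p ih =>
    rw [isMotzkinTail_cons]
    rcases k with _ | k
    · rcases h with _ | h <;> simp [motzkinTails]
    have key : ∀ m : ℕ, (m : ℤ) = h + a.forget.dh →
        ((∃ k' h' : ℕ, k + 1 = k' + 1 ∧ (h' : ℤ) = h + a.forget.dh ∧ IsMotzkinTail k' h' p) ↔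
          IsMotzkinTail k m p) := by
      intro m hm
      constructor
      · rintro ⟨k', h', hk, hh, hp⟩
        obtain rfl : k = k' := by omega
        obtain rfl : m = h' := by omega
        exact hp
      · exact fun hp => ⟨k, m, rfl, hm, hp⟩
    rcases a with b | b | _
    · rw [key (h + 1) (by simp [CMStep.forget, MStep.dh])]
      rcases h with _ | h <;> simp [motzkinTails, ih]
    · rw [key h (by simp [CMStep.forget, MStep.dh])]
      rcases h with _ | h <;> simp [motzkinTails, ih]
    · rcases h with _ | h
      · simp [motzkinTails, CMStep.forget, MStep.dh]
      · rw [key h (by simp [CMStep.forget, MStep.dh])]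
        simp [motzkinTails, ih]

lemma coeff_eq_card_motzkinTails {P : ℤ⟦X⟧} (hP : P = 2 * X + 2 * X * P + X * P ^ 2)
    (k h : ℕ) :
    coeff (k + 1) (P ^ (h + 1)) = 2 ^ (h + 1) * ((motzkinTails k h).card : ℤ) := by
  have hU : Function.Injective (fun x : Bool × List CMStep => CMStep.U x.1 :: x.2) := by
    rintro ⟨a, p⟩ ⟨b, q⟩ h
    simpa using h
  have hH : Function.Injective (fun x : Bool × List CMStep => CMStep.H x.1 :: x.2) := by
    rintro ⟨a, p⟩ ⟨b, q⟩ h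
    simpa using h
  have hUH : ∀ A B : Finset (Bool × List CMStep),
      Disjoint (A.image fun x => CMStep.U x.1 :: x.2) (B.image fun x => CMStep.H x.1 :: x.2) := by
    intro A B
    rw [Finset.disjoint_left]
    intro p hA hB
    obtain ⟨x, -, rfl⟩ := Finset.mem_image.1 hA
    obtain ⟨y, -, hy⟩ := Finset.mem_image.1 hB
    simp at hy
  have hstep : ∀ h n, coeff (n + 1) (P ^ (h + 1)) = 2 * coeff n (P ^ h) +
      2 * coeff n (P ^ (h + 1)) + coeff n (P ^ (h + 2)) := by
    intro h n
    have : P ^ (h + 1) = X * (P ^ h + P ^ h + (P ^ (h + 1) + P ^ (h + 1)) + P ^ (h + 2)) := by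
      linear_combination P ^ h * hP
    conv_lhs => rw [this]
    simp only [map_add, coeff_succ_X_mul]
    ring
  have hconst : constantCoeff P = 0 := by
    rw [hP]
    simp
  have hzero : ∀ h, coeff 0 (P ^ (h + 1)) = 0 := by
    intro h
    simp [hconst]
  induction k generalizing h with
  | zero =>
    rcases h with _ | h
    · rw [hstep, hzero, hzero]
      simp [motzkinTails]
    · rw [hstep, hzero, hzero, hzero]
      simp [motzkinTails]
  | succ k ih =>
    rcases h with _ | h
    · rw [hstep, ih, ih, motzkinTails,
        Finset.card_union_of_disjoint (hUH _ _),
        Finset.card_image_of_injective _ hU, Finset.card_image_of_injective _ hH]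
      simp [coeff_one]
      ring
    · rw [hstep, ih, ih, ih, motzkinTails,
        Finset.card_union_of_disjoint (by simp [Finset.disjoint_left]),
        Finset.card_union_of_disjoint (hUH _ _),
        Finset.card_image_of_injective _ hU, Finset.card_image_of_injective _ hH,
        Finset.card_image_of_injective _ List.cons_injective]
      simp
      ring

lemma exists_powerSeries_eq_one_add :
    ∃ S : ℤ⟦X⟧, S = 1 + (X + X ^ 2) * S ^ 2 := by
  have ha : HasSubst (X + X ^ 2 : ℤ⟦X⟧) := HasSubst.of_constantCoeff_zero' (by simp)
  refine ⟨substAlgHom (R := ℤ) ha (map (Nat.castRingHom ℤ) catalanSeries), ?_⟩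
  conv_lhs => rw [← catalanSeries_sq_mul_X_add_one]
  simp only [map_add, map_mul, map_pow, map_one, map_X, substAlgHom_X]
  ring

lemma card_schroderTails_eq (k : ℕ) :
    (schroderTails (k + 1) 0).card = 2 * (motzkinTails k 0).card := by
  obtain ⟨S, hS⟩ := exists_powerSeries_eq_one_add
  have hP : (1 + X) * S - 1 = 2 * X + 2 * X * ((1 + X) * S - 1) + X * ((1 + X) * S - 1) ^ 2 := by
    linear_combination (1 + X) * hS
  have h₁ := coeff_eq_card_schroderTails hS (k + 1) 0
  have h₂ := coeff_eq_card_motzkinTails hP k 0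
  rw [zero_add, pow_one] at h₁ h₂
  rw [map_sub, h₁, coeff_one, if_neg (by omega)] at h₂
  simp only [sub_zero, pow_one] at h₂
  exact_mod_cast h₂

lemma isSchroderTail_zero_iff {n : ℕ} {p : List SStep} :
    IsSchroderTail n 0 p ↔ IsSchroder n p ∧ DFollowedByH p := by
  simp [IsSchroderTail, IsSchroder, and_assoc]

lemma count_D_le_pathX (p : List SStep) : p.count SStep.D ≤ pathX p := by
  induction p with
  | nil => simp
  | cons a p ih =>
    rw [pathX_cons, List.count_cons]
    cases a <;> simp [SStep.dx] <;> omega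

lemma card_RP (n m : ℕ) : Nat.card (RP n m) =
    ((schroderTails n 0).filter (fun p => p.count SStep.D + m = n)).card := by
  refine Nat.subtype_card _ fun p => ?_
  rw [Finset.mem_filter, mem_schroderTails, isSchroderTail_zero_iff]
  tauto

lemma tsum_card_RP (n : ℕ) : ∑' m : ℕ, Nat.card (RP n m) = (schroderTails n 0).card := by
  simp only [card_RP]
  rw [tsum_eq_sum (s := Finset.range (n + 1))]
  · rw [Finset.card_eq_sum_card_fiberwise (f := fun p => n - p.count SStep.D)
      (t := Finset.range (n + 1)) (fun p _ => by simp)]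
    refine Finset.sum_congr rfl fun m _ => congrArg _ (Finset.filter_congr fun p hp => ?_)
    rw [mem_schroderTails] at hp
    have := count_D_le_pathX p
    have := hp.1
    omega
  · intro m hm
    rw [Finset.mem_range] at hm
    rw [Finset.card_eq_zero, Finset.filter_eq_empty_iff]
    intro p _
    omega

lemma card_huMP (n : ℕ) : Nat.card (huMP n) = (motzkinTails (n - 1) 0).card := by
  refine Nat.subtype_card _ fun p => ?_
  rw [mem_motzkinTails]
  simp [IsMotzkinTail, IsMotzkin]

end Recursion

/-- Σ_{m≥0} |RP(n,m)| = 2·|huMP(n)|. -/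
theorem statement8 (n : ℕ) (hn : 1 ≤ n) :
    ∑' m : ℕ, Nat.card (RP n m) = 2 * Nat.card (huMP n) := by
  obtain ⟨k, rfl⟩ := Nat.exists_eq_add_of_le' hn
  rw [tsum_card_RP, card_huMP, card_schroderTails_eq, Nat.add_sub_cancel]
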